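/- Let Ω be a nonempty subset of Δ̃ on which the coefficient n_α is constant, with common value n_Ω, and set λ_Ω = (1/(n_Ω·|Ω|))·Σ_{α∈Ω} ϖ_α∨. Then: (α) λ_Ω lies in C with I_{λ_Ω} = Δ̃ ∖ Ω, and W°(λ_Ω) is the subgroup of W generated by the reflections s_α with α ∈ Δ̃ ∖ Ω; (β) {w ∈ W | w(λ_Ω) − λ_Ω ∈ L and w(Δ̃ ∖ Ω) = Δ̃ ∖ Ω} = {z ∈ 𝒜_L | z(Ω) = Ω}; (δ) the only vector of V fixed by every element of W°(λ_Ω) is 0 (i.e. λ_Ω is isolated) if and only if |Ω| = 1. -/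

import Mathlib

open Module

/-- A reduced, irreducible, crystallographic root system `Φ` inside the dual of a
`ℚ`-vector space `V`: each root `α` has a coroot `α∨ ∈ V` with `⟨α, α∨⟩ = 2`, pairings
between roots and coroots are integers, the dual reflections permute the roots, the
system is reduced, the roots span `V*`, and the system is irreducible. -/
structure RootSystemData (V : Type*) [AddCommGroup V] [Module ℚ V] where
  Φ : Set (Module.Dual ℚ V)
  coroot : Module.Dual ℚ V → V
  finite : Φ.Finite
  span_eq_top : Submodule.span ℚ Φ = ⊤
  pairing_self : ∀ α ∈ Φ, α (coroot α) = 2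
  pairing_int : ∀ α ∈ Φ, ∀ β ∈ Φ, ∃ n : ℤ, (n : ℚ) = β (coroot α)
  reduced : ∀ α ∈ Φ, ∀ c : ℚ, c • α ∈ Φ → c = 1 ∨ c = -1
  dual_refl_mem : ∀ α ∈ Φ, ∀ β ∈ Φ, β - β (coroot α) • α ∈ Φ
  irreducible : ∀ s : Set (Module.Dual ℚ V), s ⊆ Φ → s.Nonempty →
      (∀ α ∈ s, ∀ β ∈ Φ, β ∉ s → β (coroot α) = 0) → s = Φ

variable {V : Type*} [AddCommGroup V] [Module ℚ V]

/-- The reflections `s_α : v ↦ v - ⟨α, v⟩ α∨` attached to the elements `α` of `S`. -/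
def reflSet (R : RootSystemData V) (S : Set (Module.Dual ℚ V)) : Set (V ≃ₗ[ℚ] V) :=
  {w | ∃ α ∈ S, ∀ v, w v = v - α v • R.coroot α}

/-- The subgroup of `GL(V)` generated by the reflections `s_α`, `α ∈ S`. -/
def weylOf (R : RootSystemData V) (S : Set (Module.Dual ℚ V)) : Subgroup (V ≃ₗ[ℚ] V) :=
  Subgroup.closure (reflSet R S)

/-- The Weyl group `W` of the root system. -/
def weyl (R : RootSystemData V) : Subgroup (V ≃ₗ[ℚ] V) :=
  weylOf R R.Φ

/-- The contragredient action of `w ∈ GL(V)` on the dual space: `β ↦ β ∘ w⁻¹`. -/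
def dact (w : V ≃ₗ[ℚ] V) (β : Module.Dual ℚ V) : Module.Dual ℚ V :=
  β.comp (w.symm.toLinearMap)

/-- The coroot lattice `Q∨`. -/
def corootLattice (R : RootSystemData V) : AddSubgroup V :=
  AddSubgroup.closure (R.coroot '' R.Φ)

/-- The coweight lattice `P∨ = {v ∈ V | ⟨α, v⟩ ∈ ℤ for all α ∈ Φ}`, as a set. -/
def coweightSet (R : RootSystemData V) : Set V :=
  {v | ∀ α ∈ R.Φ, ∃ n : ℤ, (n : ℚ) = α v}

/-- `m_α`: equal to `-1` on `α₀ = -α̃` and `0` elsewhere (in particular on `Δ`). -/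
noncomputable def mfun (αt α : Module.Dual ℚ V) : ℚ := by
  classical exact if α = -αt then -1 else 0

/-- The extended (affine) base `Δ̃ = Δ ∪ {-α̃}`. -/
def extBase (Δ : Finset (Module.Dual ℚ V)) (αt : Module.Dual ℚ V) :
    Set (Module.Dual ℚ V) :=
  insert (-αt) (Δ : Set (Module.Dual ℚ V))

/-- The closed fundamental alcove `C = {λ ∈ V | ⟨α, λ⟩ ≥ m_α for all α ∈ Δ̃}`. -/
def alcove (Δ : Finset (Module.Dual ℚ V)) (αt : Module.Dual ℚ V) : Set V :=
  {x | ∀ α ∈ extBase Δ αt, mfun αt α ≤ α x}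

/-- `Φ(λ) = {α ∈ Φ | ⟨α, λ⟩ ∈ ℤ}`. -/
def PhiOf (R : RootSystemData V) (x : V) : Set (Module.Dual ℚ V) :=
  {α | α ∈ R.Φ ∧ ∃ k : ℤ, (k : ℚ) = α x}

/-- `I_λ = {α ∈ Δ̃ | ⟨α, λ⟩ = m_α}` for `λ ∈ C`. -/
def IOf (Δ : Finset (Module.Dual ℚ V)) (αt : Module.Dual ℚ V) (x : V) :
    Set (Module.Dual ℚ V) :=
  {α | α ∈ extBase Δ αt ∧ α x = mfun αt α}

/-- `W°(λ)`: the subgroup of `W` generated by the reflections `s_α`, `α ∈ Φ(λ)`. -/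
def Wcirc (R : RootSystemData V) (x : V) : Subgroup (V ≃ₗ[ℚ] V) :=
  weylOf R (PhiOf R x)

/-- `𝒜 = {z ∈ W | z(Δ̃) = Δ̃}`: automorphisms of the affine Dynkin diagram induced by `W`. -/
def AutTilde (R : RootSystemData V) (Δ : Finset (Module.Dual ℚ V))
    (αt : Module.Dual ℚ V) : Set (V ≃ₗ[ℚ] V) :=
  {z | z ∈ weyl R ∧ dact z '' extBase Δ αt = extBase Δ αt}

/-- `𝒜_L = {z ∈ 𝒜 | ϖ∨(z) ∈ L}`, where `ϖ∨(z)` is the unique `v` with `z(C) + v = C`. -/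
def AutTildeL (R : RootSystemData V) (Δ : Finset (Module.Dual ℚ V))
    (αt : Module.Dual ℚ V) (L : AddSubgroup V) : Set (V ≃ₗ[ℚ] V) :=
  {z | z ∈ AutTilde R Δ αt ∧
    ∃ v ∈ L, (fun x => z x + v) '' alcove Δ αt = alcove Δ αt}

/-- The submodule of vectors of `V` fixed by every element of `S`. -/
def fixedSub (S : Set (V ≃ₗ[ℚ] V)) : Submodule ℚ V where
  carrier := {v | ∀ w ∈ S, w v = v}
  add_mem' := by
    intro a b ha hb w hw
    rw [map_add, ha w hw, hb w hw]
  zero_mem' := by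
    intro w hw
    exact map_zero w
  smul_mem' := by
    intro c v hv w hw
    rw [map_smul, hv w hw]

/-- The set of orbits of a subgroup `A ≤ GL(V)` acting (contragrediently) on a set `S`
of linear forms. -/
def orbitsOn (A : Subgroup (V ≃ₗ[ℚ] V)) (S : Set (Module.Dual ℚ V)) :
    Set (Set (Module.Dual ℚ V)) :=
  {O | ∃ α ∈ S, O = {β | ∃ z ∈ A, dact z α = β}}

/-- `λ_Ω = (1/(n_Ω·|Ω|))·Σ_{α∈Ω} ϖ_α∨` (written with `n_α` in place of the constant value
`n_Ω` of `n` on `Ω`). -/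
noncomputable def lamOf (n : Module.Dual ℚ V → ℕ) (ϖ : Module.Dual ℚ V → V)
    (Ω : Set (Module.Dual ℚ V)) : V :=
  ∑ᶠ α ∈ Ω, ((n α : ℚ) * (Ω.ncard : ℚ))⁻¹ • ϖ α

/-- `λ` is quasi-isolated with respect to `L` if the only vector fixed by every element of
`W_L(λ) = {w ∈ W | w(λ) - λ ∈ L}` is `0`. -/
def IsQuasiIsolated (R : RootSystemData V) (L : AddSubgroup V) (x : V) : Prop :=
  fixedSub {w : V ≃ₗ[ℚ] V | w ∈ weyl R ∧ w x - x ∈ L} = ⊥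

/-- `𝒬_L`: the set of nonempty subsets `Ω ⊆ Δ̃` whose stabilizer in `𝒜_L` acts
transitively on `Ω`. -/
def QSetOf (R : RootSystemData V) (Δ : Finset (Module.Dual ℚ V))
    (αt : Module.Dual ℚ V) (L : AddSubgroup V) : Set (Set (Module.Dual ℚ V)) :=
  {Ω | Ω ⊆ extBase Δ αt ∧ Ω.Nonempty ∧
    ∀ α ∈ Ω, ∀ β ∈ Ω, ∃ z ∈ AutTildeL R Δ αt L, dact z '' Ω = Ω ∧ dact z α = β}


namespace RootSystemData

variable (R : RootSystemData V) {α β γ : Module.Dual ℚ V}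

lemma neg_mem (hα : α ∈ R.Φ) : -α ∈ R.Φ := by
  have h := R.dual_refl_mem α hα α hα
  rw [R.pairing_self α hα] at h
  convert h using 1
  module

lemma ne_zero (hα : α ∈ R.Φ) : α ≠ 0 := by
  rintro rfl
  simpa using R.pairing_self 0 hα

/-- The coroot attached to a root is the only vector defining a reflection that permutes the
roots. -/
lemma coroot_unique [FiniteDimensional ℚ V] (hα : α ∈ R.Φ) {x : V} (hx : α x = 2)
    (h : ∀ β ∈ R.Φ, β - β x • α ∈ R.Φ) : x = R.coroot α := by
  have key := Module.Dual.eq_of_preReflection_mapsTo (R := ℚ) (M := Module.Dual ℚ V) (x := α)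
    R.finite R.span_eq_top (f := Module.Dual.eval ℚ V x)
    (g := Module.Dual.eval ℚ V (R.coroot α)) (by simpa using hx)
    (fun β hβ ↦ by simpa [Module.preReflection_apply] using h β hβ)
    (by simpa using R.pairing_self α hα)
    (fun β hβ ↦ by simpa [Module.preReflection_apply] using R.dual_refl_mem α hα β hβ)
  exact (Module.bijective_dual_eval ℚ V).1 key

lemma coroot_neg [FiniteDimensional ℚ V] (hα : α ∈ R.Φ) :
    R.coroot (-α) = -R.coroot α := by
  refine (R.coroot_unique (R.neg_mem hα) (by simp [R.pairing_self α hα]) fun β hβ ↦ ?_).symm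
  simpa using R.dual_refl_mem α hα β hβ

lemma coroot_reflect [FiniteDimensional ℚ V] (hα : α ∈ R.Φ) (hβ : β ∈ R.Φ) :
    R.coroot (β - β (R.coroot α) • α) =
      R.coroot β - α (R.coroot β) • R.coroot α := by
  have hα2 := R.pairing_self α hα
  have hβ2 := R.pairing_self β hβ
  refine (R.coroot_unique (R.dual_refl_mem α hα β hβ) ?_ fun γ hγ ↦ ?_).symm
  · simp [hα2, hβ2]
    ring
  · have h := R.dual_refl_mem α hα _ (R.dual_refl_mem β hβ _ (R.dual_refl_mem α hα γ hγ))
    convert h using 1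
    ext v
    simp [hα2]
    ring

/-- The canonical invariant bilinear form on the dual space. -/
noncomputable def form (f g : Module.Dual ℚ V) : ℚ :=
  ∑ γ ∈ R.finite.toFinset, f (R.coroot γ) * g (R.coroot γ)

lemma form_comm (f g : Module.Dual ℚ V) : R.form f g = R.form g f :=
  Finset.sum_congr rfl fun _ _ ↦ mul_comm _ _

lemma form_self_pos (hα : α ∈ R.Φ) : 0 < R.form α α := by
  refine Finset.sum_pos' (fun _ _ ↦ mul_self_nonneg _) ⟨α, by simpa using hα, ?_⟩
  rw [R.pairing_self α hα]
  norm_num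

lemma form_reflect [FiniteDimensional ℚ V] (hα : α ∈ R.Φ) (f g : Module.Dual ℚ V) :
    R.form (f - f (R.coroot α) • α) (g - g (R.coroot α) • α) = R.form f g := by
  have hα2 := R.pairing_self α hα
  have invol : ∀ γ : Module.Dual ℚ V, γ - γ (R.coroot α) • α -
      (γ - γ (R.coroot α) • α) (R.coroot α) • α = γ := by
    intro γ
    ext v
    simp [hα2]
    ring
  refine Finset.sum_nbij' (fun γ ↦ γ - γ (R.coroot α) • α) (fun γ ↦ γ - γ (R.coroot α) • α)
    ?_ ?_ (fun γ _ ↦ invol γ) (fun γ _ ↦ invol γ) ?_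
  · intro γ hγ
    simpa using R.dual_refl_mem α hα γ (by simpa using hγ)
  · intro γ hγ
    simpa using R.dual_refl_mem α hα γ (by simpa using hγ)
  · intro γ hγ
    simp only [R.coroot_reflect hα (by simpa using hγ)]
    simp
    ring

lemma two_mul_form [FiniteDimensional ℚ V] (hα : α ∈ R.Φ) (f : Module.Dual ℚ V) :
    2 * R.form f α = f (R.coroot α) * R.form α α := by
  have h := R.form_reflect hα f α
  have e : R.form (f - f (R.coroot α) • α) (α - α (R.coroot α) • α) =
      -R.form f α + f (R.coroot α) * R.form α α := by
    simp only [form, R.pairing_self α hα, Finset.mul_sum, ← Finset.sum_neg_distrib,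
      ← Finset.sum_add_distrib]
    refine Finset.sum_congr rfl fun γ _ ↦ ?_
    simp
    ring
  linarith

lemma pairing_pos_symm [FiniteDimensional ℚ V] (hα : α ∈ R.Φ) (hβ : β ∈ R.Φ)
    (h : 0 < β (R.coroot α)) : 0 < α (R.coroot β) := by
  have h1 := R.two_mul_form hα β
  have h2 := R.two_mul_form hβ α
  rw [R.form_comm] at h2
  have h3 := mul_pos h (R.form_self_pos hα)
  exact pos_of_mul_pos_left (by linarith) (R.form_self_pos hβ).le

/-- The reflection attached to a root, as an element of `GL(V)`. -/
noncomputable def refl (hα : α ∈ R.Φ) : V ≃ₗ[ℚ] V :=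
  Module.reflection (R.pairing_self α hα)

lemma refl_apply (hα : α ∈ R.Φ) (v : V) : R.refl hα v = v - α v • R.coroot α :=
  Module.reflection_apply _ _

lemma refl_mem_weylOf (hα : α ∈ R.Φ) {S : Set (Module.Dual ℚ V)} (h : α ∈ S) :
    R.refl hα ∈ weylOf R S :=
  Subgroup.subset_closure ⟨α, h, R.refl_apply hα⟩

lemma weylOf_le {S : Set (Module.Dual ℚ V)} (hS : S ⊆ R.Φ) {G : Subgroup (V ≃ₗ[ℚ] V)}
    (h : ∀ α (hα : α ∈ R.Φ), α ∈ S → R.refl hα ∈ G) : weylOf R S ≤ G := by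
  refine (Subgroup.closure_le _).2 ?_
  rintro w ⟨α, hα, hw⟩
  have : w = R.refl (hS hα) := by
    ext v
    rw [hw, R.refl_apply]
  rw [this]
  exact h α (hS hα) hα

lemma refl_neg [FiniteDimensional ℚ V] (hα : α ∈ R.Φ) :
    R.refl (R.neg_mem hα) = R.refl hα := by
  ext v
  simp [refl_apply, R.coroot_neg hα]

lemma refl_conj [FiniteDimensional ℚ V] (hα : α ∈ R.Φ) (hβ : β ∈ R.Φ) :
    R.refl hβ = R.refl hα * R.refl (R.dual_refl_mem α hα β hβ) * R.refl hα := by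
  ext v
  have hα2 := R.pairing_self α hα
  simp only [LinearEquiv.mul_apply, refl_apply, R.coroot_reflect hα hβ, LinearMap.sub_apply,
    LinearMap.smul_apply, map_sub, map_smul, smul_eq_mul, hα2]
  module

lemma dact_refl (hα : α ∈ R.Φ) (f : Module.Dual ℚ V) :
    dact (R.refl hα) f = f - f (R.coroot α) • α := by
  ext v
  have : (R.refl hα).symm v = v - α v • R.coroot α := R.refl_apply hα v
  simp [dact, this]
  ring

end RootSystemData

lemma dact_apply (w : V ≃ₗ[ℚ] V) (f : Module.Dual ℚ V) (v : V) : dact w f (w v) = f v := by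
  simp [dact]

lemma dact_inv_apply (w : V ≃ₗ[ℚ] V) (f : Module.Dual ℚ V) (v : V) :
    dact w⁻¹ f v = f (w v) := rfl

lemma dact_mul (w z : V ≃ₗ[ℚ] V) (f : Module.Dual ℚ V) :
    dact (w * z) f = dact w (dact z f) := rfl

lemma dact_one (f : Module.Dual ℚ V) : dact 1 f = f := rfl

lemma dact_inv_dact (w : V ≃ₗ[ℚ] V) (f : Module.Dual ℚ V) : dact w⁻¹ (dact w f) = f := by
  rw [← dact_mul, inv_mul_cancel, dact_one]

lemma dact_dact_inv (w : V ≃ₗ[ℚ] V) (f : Module.Dual ℚ V) : dact w (dact w⁻¹ f) = f := by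
  rw [← dact_mul, mul_inv_cancel, dact_one]

lemma dact_injective (w : V ≃ₗ[ℚ] V) : Function.Injective (dact w) :=
  Function.LeftInverse.injective (dact_inv_dact w)

lemma dact_mem (R : RootSystemData V) {w : V ≃ₗ[ℚ] V} (hw : w ∈ weyl R)
    {α : Module.Dual ℚ V} (hα : α ∈ R.Φ) : dact w α ∈ R.Φ := by
  revert α
  refine Subgroup.closure_induction (p := fun w _ ↦ ∀ {α}, α ∈ R.Φ → dact w α ∈ R.Φ)
    ?_ ?_ ?_ ?_ hw
  · rintro w ⟨β, hβ, hw⟩ α hα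
    have : w = R.refl hβ := by
      ext v
      rw [hw, R.refl_apply]
    rw [this, R.dact_refl]
    exact R.dual_refl_mem β hβ α hα
  · exact fun hα ↦ hα
  · intro x y _ _ hx hy α hα
    exact hx (hy hα)
  · intro x _ hx α hα
    obtain ⟨β, hβ, rfl⟩ := ((R.finite.injOn_iff_bijOn_of_mapsTo (fun a ha ↦ hx ha)).1
      (dact_injective x).injOn).surjOn hα
    rwa [dact_inv_dact]

lemma mem_fixedSub_weylOf_iff (R : RootSystemData V) {I : Set (Module.Dual ℚ V)}
    (hI : I ⊆ R.Φ) {v : V} :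
    v ∈ fixedSub (weylOf R I : Set (V ≃ₗ[ℚ] V)) ↔ ∀ β ∈ I, β v = 0 := by
  constructor
  · intro hv β hβ
    have h1 : R.refl (hI hβ) v = v := hv _ (R.refl_mem_weylOf (hI hβ) hβ)
    rw [R.refl_apply, sub_eq_self] at h1
    have h2 := congrArg β h1
    rw [map_smul, R.pairing_self β (hI hβ), map_zero, smul_eq_mul] at h2
    linarith
  · intro hv w hw
    have : weylOf R I ≤ MulAction.stabilizer (V ≃ₗ[ℚ] V) v := R.weylOf_le hI fun β hβ hβI ↦ by
      rw [MulAction.mem_stabilizer_iff, LinearEquiv.smul_def, R.refl_apply, hv β hβI, zero_smul,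
        sub_zero]
    exact this hw

/-- The data of a base `Δ` of a root system, together with its highest root `αt`, the coefficients
`n` of `αt` in `Δ` (extended by `1` at `-αt`) and the basis `ϖ` dual to `Δ` (extended by `0` at
`-αt`). -/
structure AffineBase (R : RootSystemData V) (Δ : Finset (Module.Dual ℚ V))
    (αt : Module.Dual ℚ V) (n : Module.Dual ℚ V → ℕ) (ϖ : Module.Dual ℚ V → V) : Prop where
  simple_mem : ∀ β ∈ Δ, β ∈ R.Φ
  high_mem : αt ∈ R.Φ
  neg_high_notMem : -αt ∉ Δ
  high_eq : αt = ∑ β ∈ Δ, (n β : ℚ) • β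
  n_pos : ∀ β ∈ Δ, 0 < n β
  n_neg_high : n (-αt) = 1
  dual_self : ∀ β ∈ Δ, β (ϖ β) = 1
  dual_ne : ∀ β ∈ Δ, ∀ γ ∈ Δ, γ ≠ β → γ (ϖ β) = 0
  dual_neg_high : ϖ (-αt) = 0
  eq_sum : ∀ f : Module.Dual ℚ V, f = ∑ β ∈ Δ, f (ϖ β) • β
  nonneg_or_nonpos : ∀ α ∈ R.Φ, (∀ β ∈ Δ, 0 ≤ α (ϖ β)) ∨ ∀ β ∈ Δ, α (ϖ β) ≤ 0
  le_n : ∀ α ∈ R.Φ, ∀ β ∈ Δ, α (ϖ β) ≤ n β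

namespace AffineBase

variable {R : RootSystemData V} {Δ : Finset (Module.Dual ℚ V)} {αt : Module.Dual ℚ V}
  {n : Module.Dual ℚ V → ℕ} {ϖ : Module.Dual ℚ V → V}

lemma eval_sum (h : AffineBase R Δ αt n ϖ) (d : Module.Dual ℚ V → ℚ) {β : Module.Dual ℚ V}
    (hβ : β ∈ Δ) : β (∑ γ ∈ Δ, d γ • ϖ γ) = d β := by
  rw [map_sum, Finset.sum_eq_single_of_mem β hβ]
  · simp [h.dual_self β hβ]
  · intro γ hγ hne
    simp [h.dual_ne γ hγ β hβ hne.symm]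

lemma sum_eval (h : AffineBase R Δ αt n ϖ) (d : Module.Dual ℚ V → ℚ) {β : Module.Dual ℚ V}
    (hβ : β ∈ Δ) : (∑ γ ∈ Δ, d γ • γ) (ϖ β) = d β := by
  rw [LinearMap.sum_apply, Finset.sum_eq_single_of_mem β hβ]
  · simp [h.dual_self β hβ]
  · intro γ hγ hne
    simp [h.dual_ne β hβ γ hγ hne]

lemma apply_eq_sum (h : AffineBase R Δ αt n ϖ) (f : Module.Dual ℚ V) (x : V) :
    f x = ∑ β ∈ Δ, f (ϖ β) * β x := by
  conv_lhs => rw [h.eq_sum f]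
  simp

lemma high_apply (h : AffineBase R Δ αt n ϖ) (x : V) : αt x = ∑ β ∈ Δ, (n β : ℚ) * β x := by
  conv_lhs => rw [h.high_eq]
  simp

lemma high_dual (h : AffineBase R Δ αt n ϖ) {β : Module.Dual ℚ V} (hβ : β ∈ Δ) :
    αt (ϖ β) = n β := by
  conv_lhs => rw [h.high_eq]
  exact h.sum_eval (fun γ ↦ (n γ : ℚ)) hβ

lemma mfun_simple (h : AffineBase R Δ αt n ϖ) {β : Module.Dual ℚ V} (hβ : β ∈ Δ) :
    mfun αt β = 0 := by
  have : β ≠ -αt := fun e ↦ h.neg_high_notMem (e ▸ hβ)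
  simp [mfun, this]

lemma mfun_neg_high : mfun αt (-αt) = -1 := by
  simp [mfun]

lemma ext_mem (h : AffineBase R Δ αt n ϖ) {β : Module.Dual ℚ V} (hβ : β ∈ extBase Δ αt) :
    β ∈ R.Φ := by
  rcases hβ with rfl | hβ
  · exact R.neg_mem h.high_mem
  · exact h.simple_mem β hβ

lemma exists_int_mfun (β : Module.Dual ℚ V) : ∃ k : ℤ, (k : ℚ) = mfun αt β := by
  by_cases hβ : β = -αt
  · exact ⟨-1, by simp [mfun, hβ]⟩
  · exact ⟨0, by simp [mfun, hβ]⟩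

lemma eq_of_forall_simple (h : AffineBase R Δ αt n ϖ) {x y : V} (hxy : ∀ β ∈ Δ, β x = β y) :
    x = y := by
  refine Module.eval_apply_injective ℚ (LinearMap.ext fun f ↦ ?_)
  rw [Module.Dual.eval_apply, Module.Dual.eval_apply, h.apply_eq_sum f x, h.apply_eq_sum f y]
  exact Finset.sum_congr rfl fun β hβ ↦ by rw [hxy β hβ]

lemma mem_alcove_iff (h : AffineBase R Δ αt n ϖ) {x : V} :
    x ∈ alcove Δ αt ↔ (∀ β ∈ Δ, 0 ≤ β x) ∧ αt x ≤ 1 := by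
  constructor
  · intro hx
    refine ⟨fun β hβ ↦ ?_, ?_⟩
    · simpa [h.mfun_simple hβ] using hx β (Or.inr hβ)
    · have := hx (-αt) (Or.inl rfl)
      rw [mfun_neg_high, LinearMap.neg_apply] at this
      linarith
  · rintro ⟨h1, h2⟩ β (rfl | hβ)
    · rw [mfun_neg_high, LinearMap.neg_apply]
      linarith
    · rw [h.mfun_simple hβ]
      exact h1 β hβ

/-- Points of `V` with prescribed barycentric coordinates. -/
lemma exists_barycentric (h : AffineBase R Δ αt n ϖ) (t : Module.Dual ℚ V → ℚ)
    (ht : t (-αt) + ∑ β ∈ Δ, (n β : ℚ) * t β = 1) :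
    ∃ x, ∀ β ∈ extBase Δ αt, β x = mfun αt β + t β := by
  refine ⟨∑ γ ∈ Δ, t γ • ϖ γ, ?_⟩
  rintro β (rfl | hβ)
  · rw [mfun_neg_high, LinearMap.neg_apply, h.high_apply,
      Finset.sum_congr rfl fun β hβ ↦ by rw [h.eval_sum t hβ]]
    linarith
  · rw [h.eval_sum t hβ, h.mfun_simple hβ, zero_add]

/-- Every nonempty set of walls is the set of walls avoided by some point of the alcove. -/
lemma exists_mem_alcove (h : AffineBase R Δ αt n ϖ) {S : Set (Module.Dual ℚ V)}
    (hS : (extBase Δ αt ∩ S).Nonempty) :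
    ∃ x ∈ alcove Δ αt, ∀ β ∈ extBase Δ αt,
      (β ∈ S → mfun αt β < β x) ∧ (β ∉ S → β x = mfun αt β) := by
  classical
  let u : Module.Dual ℚ V → ℚ := fun β ↦ if β ∈ S then 1 else 0
  have hu : ∀ β, 0 ≤ u β := fun β ↦ by
    simp only [u]
    split_ifs <;> norm_num
  let N : ℚ := u (-αt) + ∑ β ∈ Δ, (n β : ℚ) * u β
  have hterm : ∀ β ∈ Δ, 0 ≤ (n β : ℚ) * u β := fun β _ ↦ mul_nonneg (Nat.cast_nonneg _) (hu β)
  have hN : 0 < N := by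
    obtain ⟨β, rfl | hβ, hβS⟩ := hS
    · exact add_pos_of_pos_of_nonneg (by simp [u, hβS]) (Finset.sum_nonneg hterm)
    · refine add_pos_of_nonneg_of_pos (hu _) (Finset.sum_pos' hterm ⟨β, hβ, ?_⟩)
      simpa [u, hβS] using h.n_pos β hβ
  obtain ⟨x, hx⟩ := h.exists_barycentric (fun β ↦ u β / N) (by
    have : ∑ β ∈ Δ, (n β : ℚ) * (u β / N) = (∑ β ∈ Δ, (n β : ℚ) * u β) / N := by
      rw [Finset.sum_div]
      exact Finset.sum_congr rfl fun _ _ ↦ by ring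
    rw [this, ← add_div]
    exact div_self hN.ne')
  have hpos : ∀ β, 0 ≤ u β / N := fun β ↦ div_nonneg (hu β) hN.le
  refine ⟨x, fun β hβ ↦ ?_, fun β hβ ↦ ⟨fun hβS ↦ ?_, fun hβS ↦ ?_⟩⟩
  · rw [hx β hβ]
    linarith [hpos β]
  · rw [hx β hβ]
    have : 0 < u β / N := div_pos (by simp [u, hβS]) hN
    linarith
  · rw [hx β hβ]
    simp [u, hβS]

/-- The elements of the extended base other than a given one take arbitrary values. -/
lemma exists_interpolation (h : AffineBase R Δ αt n ϖ) {b : Module.Dual ℚ V}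
    (hb : b ∈ extBase Δ αt) (f : Module.Dual ℚ V → ℚ) :
    ∃ x, ∀ β ∈ extBase Δ αt, β ≠ b → β x = f β := by
  rcases hb with rfl | hb
  · refine ⟨∑ γ ∈ Δ, f γ • ϖ γ, ?_⟩
    rintro β (rfl | hβ) hne
    · exact absurd rfl hne
    · exact h.eval_sum f hβ
  · have hn : (n b : ℚ) ≠ 0 := by exact_mod_cast (h.n_pos b hb).ne'
    let x₀ := ∑ γ ∈ Δ, f γ • ϖ γ
    refine ⟨x₀ + ((-αt x₀ - f (-αt)) / n b) • ϖ b, ?_⟩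
    rintro β (rfl | hβ) hne
    · simp only [map_add, map_smul, LinearMap.neg_apply, h.high_dual hb, smul_eq_mul]
      field_simp
      ring
    · have : β x₀ = f β := h.eval_sum f hβ
      simp [this, h.dual_ne b hb β hβ hne]

/-- A point of the alcove misses at least one wall. -/
lemma exists_notMem_IOf (h : AffineBase R Δ αt n ϖ) (x : V) :
    ∃ b ∈ extBase Δ αt, b ∉ IOf Δ αt x := by
  by_contra! hall
  have h1 : αt x = 0 := by
    rw [h.high_apply]
    refine Finset.sum_eq_zero fun β hβ ↦ ?_
    rw [(hall β (Or.inr hβ)).2, h.mfun_simple hβ, mul_zero]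
  have h2 := (hall (-αt) (Or.inl rfl)).2
  rw [mfun_neg_high, LinearMap.neg_apply, h1] at h2
  norm_num at h2

lemma apply_nonneg (h : AffineBase R Δ αt n ϖ) {f : Module.Dual ℚ V}
    (hf : ∀ β ∈ Δ, 0 ≤ f (ϖ β)) {x : V} (hx : x ∈ alcove Δ αt) : 0 ≤ f x := by
  rw [h.apply_eq_sum]
  exact Finset.sum_nonneg fun β hβ ↦ mul_nonneg (hf β hβ) ((h.mem_alcove_iff.1 hx).1 β hβ)

lemma le_high_apply (h : AffineBase R Δ αt n ϖ) {α : Module.Dual ℚ V} (hα : α ∈ R.Φ) {x : V}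
    (hx : x ∈ alcove Δ αt) : α x ≤ αt x := by
  have := h.apply_nonneg (f := αt - α) (fun β hβ ↦ by
    rw [LinearMap.sub_apply, h.high_dual hβ]
    linarith [h.le_n α hα β hβ]) hx
  rw [LinearMap.sub_apply] at this
  linarith

lemma simple_apply_eq_zero (h : AffineBase R Δ αt n ϖ) {f : Module.Dual ℚ V}
    (hf : ∀ β ∈ Δ, 0 ≤ f (ϖ β)) {x : V} (hx : x ∈ alcove Δ αt) (hfx : f x = 0)
    {β : Module.Dual ℚ V} (hβ : β ∈ Δ) (hne : f (ϖ β) ≠ 0) : β x = 0 := by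
  rw [h.apply_eq_sum] at hfx
  have := (Finset.sum_eq_zero_iff_of_nonneg fun β hβ ↦
    mul_nonneg (hf β hβ) ((h.mem_alcove_iff.1 hx).1 β hβ)).1 hfx β hβ
  exact (mul_eq_zero.1 this).resolve_left hne

/-- The cone generated by the walls of the alcove passing through `x`. -/
def wallCone (Δ : Finset (Module.Dual ℚ V)) (αt : Module.Dual ℚ V) (x : V) :
    Set (Module.Dual ℚ V) :=
  {f | ∃ d : Module.Dual ℚ V → ℚ, (∀ β, 0 ≤ d β) ∧ (∀ β, d β ≠ 0 → β ∈ IOf Δ αt x) ∧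
    f = d (-αt) • (-αt) + ∑ β ∈ Δ, d β • β}

lemma mem_wallCone_of_nonneg (h : AffineBase R Δ αt n ϖ) {f : Module.Dual ℚ V} {x : V}
    (hx : x ∈ alcove Δ αt) (hf : ∀ β ∈ Δ, 0 ≤ f (ϖ β)) (hfx : f x = 0) {t : ℚ} (ht : 0 ≤ t)
    (htx : t ≠ 0 → αt x = 1) : t • (-αt) + f ∈ wallCone Δ αt x := by
  classical
  refine ⟨fun β ↦ if β = -αt then t else if β ∈ Δ then f (ϖ β) else 0, ?_, ?_, ?_⟩
  · intro β
    dsimp only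
    split_ifs with h1 h2
    exacts [ht, hf β h2, le_rfl]
  · intro β hβ
    dsimp only at hβ
    split_ifs at hβ with h1 h2
    · rw [h1]
      exact ⟨Or.inl rfl, by rw [mfun_neg_high, LinearMap.neg_apply, htx hβ]⟩
    · exact ⟨Or.inr h2, by
        rw [h.mfun_simple h2, h.simple_apply_eq_zero hf hx hfx h2 hβ]⟩
    · exact absurd rfl hβ
  · simp only [if_true]
    congr 1
    conv_lhs => rw [h.eq_sum f]
    refine Finset.sum_congr rfl fun β hβ ↦ ?_
    have : β ≠ -αt := fun e ↦ h.neg_high_notMem (e ▸ hβ)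
    simp [this, hβ]

lemma nonneg_or_neg_nonneg (h : AffineBase R Δ αt n ϖ) {α : Module.Dual ℚ V} (hα : α ∈ R.Φ) :
    (∀ β ∈ Δ, 0 ≤ α (ϖ β)) ∨ ∀ β ∈ Δ, 0 ≤ (-α) (ϖ β) := by
  simpa using h.nonneg_or_nonpos α hα

/-- A root taking an integral value at a point `x` of the alcove lies, up to sign, in the cone
generated by the walls passing through `x`. -/
lemma mem_wallCone_or_neg_mem (h : AffineBase R Δ αt n ϖ) {α : Module.Dual ℚ V} (hα : α ∈ R.Φ)
    {x : V} (hx : x ∈ alcove Δ αt) (hint : ∃ k : ℤ, (k : ℚ) = α x) :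
    α ∈ wallCone Δ αt x ∨ -α ∈ wallCone Δ αt x := by
  have key : ∀ α ∈ R.Φ, (∃ k : ℤ, (k : ℚ) = α x) → (∀ β ∈ Δ, 0 ≤ α (ϖ β)) →
      α ∈ wallCone Δ αt x ∨ -α ∈ wallCone Δ αt x := by
    rintro α hα ⟨k, hk⟩ hpos
    have h0 : 0 ≤ α x := h.apply_nonneg hpos hx
    have h1 : α x ≤ αt x := h.le_high_apply hα hx
    have h2 : αt x ≤ 1 := (h.mem_alcove_iff.1 hx).2
    have hk0 : 0 ≤ k := by exact_mod_cast hk ▸ h0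
    have hk1 : k ≤ 1 := by
      have : (k : ℚ) ≤ 1 := by linarith
      exact_mod_cast this
    obtain rfl | rfl : k = 0 ∨ k = 1 := by lia
    · left
      simpa using h.mem_wallCone_of_nonneg hx hpos (by simpa using hk.symm) (t := 0) le_rfl
        (by simp)
    · right
      push_cast at hk
      have h3 : αt x = 1 := by linarith
      have := h.mem_wallCone_of_nonneg hx (f := αt - α) (fun β hβ ↦ by
        rw [LinearMap.sub_apply, h.high_dual hβ]
        linarith [h.le_n α hα β hβ]) (by simp [h3, ← hk]) (t := 1) zero_le_one (fun _ ↦ h3)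
      convert this using 1
      module
  rcases h.nonneg_or_neg_nonneg hα with hpos | hneg
  · exact key α hα hint hpos
  · obtain ⟨k, hk⟩ := hint
    have := key (-α) (R.neg_mem hα) ⟨-k, by simp [hk]⟩ hneg
    rw [neg_neg] at this
    exact this.symm

lemma wallCone_apply_nonneg {f : Module.Dual ℚ V} {x y : V} (hf : f ∈ wallCone Δ αt x)
    (hy : ∀ β ∈ IOf Δ αt x, 0 ≤ β y) : 0 ≤ f y := by
  obtain ⟨d, hd, hI, rfl⟩ := hf
  have hterm : ∀ β, 0 ≤ d β * β y := fun β ↦ by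
    by_cases hβ : d β = 0
    · simp [hβ]
    · exact mul_nonneg (hd β) (hy β (hI β hβ))
  simp only [LinearMap.add_apply, LinearMap.smul_apply, LinearMap.sum_apply, smul_eq_mul]
  exact add_nonneg (hterm _) (Finset.sum_nonneg fun β _ ↦ hterm β)

lemma exists_pos_of_mem_wallCone {f : Module.Dual ℚ V} {x y : V} (hf : f ∈ wallCone Δ αt x)
    (hy : 0 < f y) : ∃ β ∈ IOf Δ αt x, 0 < β y := by
  by_contra! hle
  have := wallCone_apply_nonneg (y := -y) hf fun β hβ ↦ by
    rw [map_neg]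
    linarith [hle β hβ]
  rw [map_neg] at this
  linarith

lemma exists_mem_IOf_of_mem_wallCone {f : Module.Dual ℚ V} {x : V}
    (hf : f ∈ wallCone Δ αt x) (hf0 : f ≠ 0) : (IOf Δ αt x).Nonempty := by
  by_contra hempty
  rw [Set.not_nonempty_iff_eq_empty] at hempty
  refine hf0 (LinearMap.ext fun y ↦ le_antisymm ?_ ?_)
  · have := wallCone_apply_nonneg (y := -y) hf (by simp [hempty])
    simpa using this
  · exact wallCone_apply_nonneg hf (by simp [hempty])

lemma eq_or_exists_of_mem_wallCone (h : AffineBase R Δ αt n ϖ) {α β : Module.Dual ℚ V}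
    (hα : α ∈ R.Φ) {x : V} (hαx : α ∈ wallCone Δ αt x) (hβ : β ∈ IOf Δ αt x) :
    α = β ∨ ∃ y, β y = 0 ∧ (∀ γ ∈ IOf Δ αt x, 0 ≤ γ y) ∧ 0 < α y := by
  classical
  obtain ⟨b, hb, hbx⟩ := h.exists_notMem_IOf x
  obtain ⟨y, hy⟩ := h.exists_interpolation hb (fun γ ↦ if γ = β then 0 else 1)
  have hyI : ∀ γ ∈ IOf Δ αt x, γ y = if γ = β then 0 else 1 := fun γ hγ ↦
    hy γ hγ.1 fun e ↦ hbx (e ▸ hγ)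
  have hnonneg : ∀ γ ∈ IOf Δ αt x, 0 ≤ γ y := fun γ hγ ↦ by
    rw [hyI γ hγ]
    split_ifs <;> norm_num
  rcases (wallCone_apply_nonneg hαx hnonneg).lt_or_eq with hpos | hzero
  · exact Or.inr ⟨y, by simp [hyI β hβ], hnonneg, hpos⟩
  left
  obtain ⟨d, hd, hI, hsum⟩ := hαx
  rw [← Finset.sum_insert (f := fun γ ↦ d γ • γ) h.neg_high_notMem] at hsum
  have hterm : ∀ γ, 0 ≤ d γ * γ y := fun γ ↦ by
    by_cases hγ : d γ = 0
    · simp [hγ]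
    · exact mul_nonneg (hd γ) (hnonneg γ (hI γ hγ))
  have hsumy : ∑ γ ∈ insert (-αt) Δ, d γ * γ y = 0 := by
    rw [hzero, hsum]
    simp only [LinearMap.smul_apply, LinearMap.sum_apply, smul_eq_mul]
  have hd0 : ∀ γ ∈ insert (-αt) Δ, γ ≠ β → d γ = 0 := fun γ hγ hne ↦ by
    by_contra hdγ
    have := (Finset.sum_eq_zero_iff_of_nonneg fun γ _ ↦ hterm γ).1 hsumy γ hγ
    rw [hyI γ (hI γ hdγ), if_neg hne, mul_one] at this
    exact hdγ this
  have hβΔ : β ∈ insert (-αt) Δ := by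
    rcases hβ.1 with hβ | hβ
    · exact Finset.mem_insert.2 (Or.inl hβ)
    · exact Finset.mem_insert_of_mem hβ
  rw [Finset.sum_eq_single_of_mem β hβΔ fun γ hγ hne ↦ by rw [hd0 γ hγ hne, zero_smul]] at hsum
  rcases R.reduced β (h.ext_mem hβ.1) (d β) (hsum ▸ hα) with h1 | h1
  · rw [hsum, h1, one_smul]
  · linarith [hd β]

/-- The reflections attached to the roots in the wall cone of `x` are generated by the reflections
in the walls through `x`. -/
lemma refl_mem_of_mem_wallCone [FiniteDimensional ℚ V] (h : AffineBase R Δ αt n ϖ) {x : V}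
    (hx : x ∈ alcove Δ αt) {α : Module.Dual ℚ V} (hα : α ∈ R.Φ)
    (hint : ∃ k : ℤ, (k : ℚ) = α x) (hαx : α ∈ wallCone Δ αt x) :
    R.refl hα ∈ weylOf R (IOf Δ αt x) := by
  obtain ⟨b, hb, hbx⟩ := h.exists_notMem_IOf x
  obtain ⟨ρ, hρ⟩ := h.exists_interpolation hb (fun _ ↦ 1)
  have hρI : ∀ γ ∈ IOf Δ αt x, γ ρ = 1 := fun γ hγ ↦ hρ γ hγ.1 fun e ↦ hbx (e ▸ hγ)
  have hρ0 : ∀ f ∈ wallCone Δ αt x, 0 ≤ f ρ := fun f hf ↦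
    wallCone_apply_nonneg hf fun γ hγ ↦ by rw [hρI γ hγ]; exact zero_le_one
  obtain ⟨N, hN⟩ := exists_nat_gt (α ρ)
  induction N generalizing α with
  | zero =>
    rw [Nat.cast_zero] at hN
    exact absurd (hρ0 α hαx) (not_le.2 hN)
  | succ N ih =>
    obtain ⟨β, hβI, hβpos⟩ := exists_pos_of_mem_wallCone hαx
      (by rw [R.pairing_self α hα]; norm_num)
    have hβ : β ∈ R.Φ := h.ext_mem hβI.1
    have hpos : 0 < α (R.coroot β) := R.pairing_pos_symm hα hβ hβpos
    obtain ⟨m, hm⟩ := R.pairing_int β hβ α hα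
    have hm1 : (1 : ℚ) ≤ m := by
      have : 0 < m := by exact_mod_cast hm ▸ hpos
      exact_mod_cast this
    rcases h.eq_or_exists_of_mem_wallCone hα hαx hβI with rfl | ⟨y, hy0, hyI, hyα⟩
    · exact R.refl_mem_weylOf hα hβI
    have hα' := R.dual_refl_mem β hβ α hα
    have hint' : ∃ k : ℤ, (k : ℚ) = (α - α (R.coroot β) • β) x := by
      obtain ⟨k, hk⟩ := hint
      obtain ⟨l, hl⟩ := exists_int_mfun (αt := αt) β
      refine ⟨k - m * l, ?_⟩
      push_cast
      rw [hk, hm, hl, ← hβI.2]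
      simp
    have hα'x : α - α (R.coroot β) • β ∈ wallCone Δ αt x := by
      refine (h.mem_wallCone_or_neg_mem hα' hx hint').resolve_right fun hneg ↦ ?_
      have := wallCone_apply_nonneg hneg hyI
      simp only [LinearMap.neg_apply, LinearMap.sub_apply, LinearMap.smul_apply, hy0, smul_eq_mul,
        mul_zero, sub_zero] at this
      linarith
    have hrefl := ih hα' hint' hα'x (by
      simp only [LinearMap.sub_apply, LinearMap.smul_apply, hρI β hβI, smul_eq_mul, mul_one,
        ← hm]
      push_cast at hN
      linarith)
    have hs := R.refl_mem_weylOf hβ hβI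
    rw [R.refl_conj hβ hα]
    exact mul_mem (mul_mem hs hrefl) hs

/-- For a point `x` of the alcove, `W°(x)` is generated by the reflections in the walls
through `x`. -/
theorem Wcirc_eq [FiniteDimensional ℚ V] (h : AffineBase R Δ αt n ϖ) {x : V}
    (hx : x ∈ alcove Δ αt) : Wcirc R x = weylOf R (IOf Δ αt x) := by
  apply le_antisymm
  · refine R.weylOf_le (fun α hα ↦ hα.1) fun α hα hint ↦ ?_
    rcases h.mem_wallCone_or_neg_mem hα hx hint.2 with hpos | hneg
    · exact h.refl_mem_of_mem_wallCone hx hα hint.2 hpos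
    · obtain ⟨k, hk⟩ := hint.2
      rw [← R.refl_neg hα]
      exact h.refl_mem_of_mem_wallCone hx (R.neg_mem hα) ⟨-k, by simp [hk]⟩ hneg
  · refine Subgroup.closure_mono ?_
    rintro w ⟨β, hβ, hw⟩
    exact ⟨β, ⟨h.ext_mem hβ.1, hβ.2 ▸ exists_int_mfun β⟩, hw⟩

/-- The interior of the fundamental alcove. -/
def openAlcove (Δ : Finset (Module.Dual ℚ V)) (αt : Module.Dual ℚ V) : Set V :=
  {x | ∀ β ∈ extBase Δ αt, mfun αt β < β x}

lemma openAlcove_subset : openAlcove Δ αt ⊆ alcove Δ αt := fun _ hx β hβ ↦ (hx β hβ).le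

lemma openAlcove_nonempty (h : AffineBase R Δ αt n ϖ) : (openAlcove Δ αt).Nonempty := by
  obtain ⟨x, -, hx⟩ := h.exists_mem_alcove (S := Set.univ) ⟨-αt, Or.inl rfl, trivial⟩
  exact ⟨x, fun β hβ ↦ (hx β hβ).1 trivial⟩

lemma apply_pos_of_mem_openAlcove (h : AffineBase R Δ αt n ϖ) {f : Module.Dual ℚ V}
    (hf0 : f ≠ 0) (hf : ∀ β ∈ Δ, 0 ≤ f (ϖ β)) {x : V} (hx : x ∈ openAlcove Δ αt) : 0 < f x := by
  have hx' := openAlcove_subset hx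
  refine (h.apply_nonneg hf hx').lt_of_ne' fun hfx ↦ hf0 ?_
  rw [h.eq_sum f]
  refine Finset.sum_eq_zero fun β hβ ↦ ?_
  by_contra hne
  have hβx := hx β (Or.inr hβ)
  rw [h.mfun_simple hβ, h.simple_apply_eq_zero hf hx' hfx hβ fun e ↦ hne (by rw [e, zero_smul])]
    at hβx
  exact lt_irrefl _ hβx

/-- No root takes an integral value in the interior of the alcove. -/
lemma exists_int_bounds (h : AffineBase R Δ αt n ϖ) {α : Module.Dual ℚ V} (hα : α ∈ R.Φ) :
    ∃ k : ℤ, (∀ x ∈ alcove Δ αt, (k : ℚ) ≤ α x) ∧ ∀ x ∈ openAlcove Δ αt, α x < k + 1 := by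
  rcases h.nonneg_or_neg_nonneg hα with hpos | hneg
  · refine ⟨0, fun x hx ↦ by simpa using h.apply_nonneg hpos hx, fun x hx ↦ ?_⟩
    have h1 := hx (-αt) (Or.inl rfl)
    rw [mfun_neg_high, LinearMap.neg_apply] at h1
    have := h.le_high_apply hα (openAlcove_subset hx)
    push_cast
    linarith
  · have hα' := R.neg_mem hα
    refine ⟨-1, fun x hx ↦ ?_, fun x hx ↦ ?_⟩
    · have h1 := (h.mem_alcove_iff.1 hx).2
      have h2 := h.le_high_apply hα' hx
      rw [LinearMap.neg_apply] at h2
      push_cast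
      linarith
    · have := h.apply_pos_of_mem_openAlcove (R.ne_zero hα') hneg hx
      rw [LinearMap.neg_apply] at this
      push_cast
      linarith

/-- An affine transformation in the extended affine Weyl group that maps some interior point of the
alcove to an interior point preserves the alcove. -/
lemma mapsTo_alcove (h : AffineBase R Δ αt n ϖ) {w : V ≃ₗ[ℚ] V} (hw : w ∈ weyl R) {v : V}
    (hv : v ∈ coweightSet R) {y : V} (hy : y ∈ openAlcove Δ αt)
    (hwy : w y + v ∈ openAlcove Δ αt) {c : V} (hc : c ∈ alcove Δ αt) : w c + v ∈ alcove Δ αt := by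
  intro α hα
  obtain ⟨k, hk, hk'⟩ := h.exists_int_bounds (dact_mem R (inv_mem hw) (h.ext_mem hα))
  obtain ⟨l, hl⟩ := hv α (h.ext_mem hα)
  obtain ⟨m, hm⟩ := exists_int_mfun (αt := αt) α
  have h1 := hwy α hα
  have h2 := hk' y hy
  have h3 := hk c hc
  rw [dact_inv_apply] at h2 h3
  rw [map_add, ← hl, ← hm] at h1
  rw [map_add, ← hl, ← hm]
  have h4 : m ≤ k + l := by
    have : (m : ℚ) < k + l + 1 := by linarith
    have : m < k + l + 1 := by exact_mod_cast this
    lia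
  have h5 : (m : ℚ) ≤ k + l := by exact_mod_cast h4
  linarith

open Filter Topology in
lemma eventually_mem_openAlcove {x y : V} (hx : x ∈ alcove Δ αt)
    (hy : ∀ β ∈ IOf Δ αt x, 0 < β y) : ∀ᶠ t : ℚ in 𝓝[>] 0, x + t • y ∈ openAlcove Δ αt := by
  have hfin : (extBase Δ αt).Finite := Δ.finite_toSet.insert _
  refine (eventually_all_finite hfin).2 fun β hβ ↦ ?_
  simp only [map_add, map_smul, smul_eq_mul]
  by_cases hβx : β x = mfun αt β
  · filter_upwards [self_mem_nhdsWithin] with t ht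
    have := mul_pos (Set.mem_Ioi.1 ht) (hy β ⟨hβ, hβx⟩)
    linarith
  · have hlim : Tendsto (fun t : ℚ ↦ β x + t * β y) (𝓝[>] 0) (𝓝 (β x)) := by
      have : Continuous fun t : ℚ ↦ β x + t * β y := by fun_prop
      simpa using (this.tendsto 0).mono_left nhdsWithin_le_nhds
    exact hlim.eventually_const_lt ((hx β hβ).lt_of_ne' hβx)

/-- If `w` stabilizes the walls through a point `x` of the alcove, then the affine transformation
with linear part `w` that fixes `x` preserves the alcove. -/
lemma mapsTo_alcove_of_image_IOf (h : AffineBase R Δ αt n ϖ) {w : V ≃ₗ[ℚ] V} (hw : w ∈ weyl R)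
    {x : V} (hx : x ∈ alcove Δ αt) (hI : dact w '' IOf Δ αt x = IOf Δ αt x)
    (hv : x - w x ∈ coweightSet R) {c : V} (hc : c ∈ alcove Δ αt) :
    w c + (x - w x) ∈ alcove Δ αt := by
  obtain ⟨b, hb, hbx⟩ := h.exists_notMem_IOf x
  obtain ⟨y, hy⟩ := h.exists_interpolation hb (fun _ ↦ 1)
  have hyI : ∀ β ∈ IOf Δ αt x, β y = 1 := fun β hβ ↦ hy β hβ.1 fun e ↦ hbx (e ▸ hβ)
  have hwyI : ∀ β ∈ IOf Δ αt x, β (w y) = 1 := fun β hβ ↦ by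
    obtain ⟨γ, hγ, rfl⟩ := hI.symm ▸ hβ
    rw [dact_apply, hyI γ hγ]
  obtain ⟨t, ht, ht'⟩ := ((eventually_mem_openAlcove hx fun β hβ ↦
    (hyI β hβ).symm ▸ zero_lt_one).and (eventually_mem_openAlcove hx fun β hβ ↦
    (hwyI β hβ).symm ▸ zero_lt_one)).exists
  refine h.mapsTo_alcove hw hv ht ?_ hc
  convert ht' using 1
  rw [map_add, map_smul]
  abel

lemma exists_mem_alcove_IOf_eq (h : AffineBase R Δ αt n ϖ) {α : Module.Dual ℚ V}
    (hα : α ∈ extBase Δ αt) : ∃ x ∈ alcove Δ αt, IOf Δ αt x = {α} := by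
  have hne : (extBase Δ αt ∩ {α}ᶜ).Nonempty := by
    rcases hα with rfl | hα
    · obtain ⟨β, hβ⟩ : Δ.Nonempty := by
        by_contra hempty
        rw [Finset.not_nonempty_iff_eq_empty] at hempty
        refine R.ne_zero h.high_mem ?_
        rw [h.high_eq, hempty, Finset.sum_empty]
      exact ⟨β, Or.inr hβ, fun e ↦ h.neg_high_notMem (e ▸ hβ)⟩
    · exact ⟨-αt, Or.inl rfl, fun e ↦ h.neg_high_notMem (e ▸ hα)⟩
  obtain ⟨x, hx, hx'⟩ := h.exists_mem_alcove hne
  refine ⟨x, hx, Set.ext fun β ↦ ⟨fun hβ ↦ ?_, ?_⟩⟩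
  · by_contra hβα
    exact ((hx' β hβ.1).1 hβα).ne' hβ.2
  · rintro rfl
    exact ⟨hα, (hx' β hα).2 (by simp)⟩

/-- The linear part of an affine transformation preserving the alcove permutes the extended
base. -/
lemma dact_inv_mem_extBase (h : AffineBase R Δ αt n ϖ) {w : V ≃ₗ[ℚ] V} (hw : w ∈ weyl R) {v : V}
    (hv : v ∈ coweightSet R) (hmaps : ∀ c ∈ alcove Δ αt, w c + v ∈ alcove Δ αt)
    (hinv : ∀ c ∈ alcove Δ αt, w⁻¹ (c - v) ∈ alcove Δ αt) {α : Module.Dual ℚ V}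
    (hα : α ∈ extBase Δ αt) : dact w⁻¹ α ∈ extBase Δ αt := by
  obtain ⟨x, hx, hxα⟩ := h.exists_mem_alcove_IOf_eq hα
  have hαx : α x = mfun αt α := (hxα.symm ▸ rfl : α ∈ IOf Δ αt x).2
  obtain ⟨c, hc, hcx⟩ : ∃ c ∈ alcove Δ αt, w c + v = x :=
    ⟨w⁻¹ (x - v), hinv x hx, by
      rw [← LinearEquiv.mul_apply, mul_inv_cancel, LinearEquiv.coe_one, id_eq, sub_add_cancel]⟩
  have hαc : α (w c) = mfun αt α - α v := by rw [← hαx, ← hcx, map_add, add_sub_cancel_right]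
  have hβ := dact_mem R (inv_mem hw) (h.ext_mem hα)
  obtain ⟨m, hm⟩ := exists_int_mfun (αt := αt) α
  obtain ⟨l, hl⟩ := hv α (h.ext_mem hα)
  obtain ⟨γ, hγ⟩ : (IOf Δ αt c).Nonempty := by
    rcases h.mem_wallCone_or_neg_mem hβ hc
      ⟨m - l, by rw [dact_inv_apply, hαc, ← hm, ← hl]; push_cast; rfl⟩ with hpos | hneg
    · exact exists_mem_IOf_of_mem_wallCone hpos (R.ne_zero hβ)
    · exact exists_mem_IOf_of_mem_wallCone hneg (R.ne_zero (R.neg_mem hβ))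
  have hγ' := dact_mem R hw (h.ext_mem hγ.1)
  have hγ'x : ∃ k : ℤ, (k : ℚ) = dact w γ x := by
    obtain ⟨k, hk⟩ := hv _ hγ'
    obtain ⟨j, hj⟩ := exists_int_mfun (αt := αt) γ
    refine ⟨j + k, ?_⟩
    rw [← hcx, map_add, dact_apply, hγ.2, ← hj, ← hk]
    push_cast
    rfl
  have key : ∀ δ ∈ R.Φ, δ ∈ wallCone Δ αt x → δ = α := fun δ hδ hδx ↦ by
    refine (h.eq_or_exists_of_mem_wallCone hδ hδx (hxα.symm ▸ rfl)).resolve_right ?_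
    rintro ⟨y, hy0, -, hδy⟩
    have := wallCone_apply_nonneg (y := -y) hδx fun β hβ ↦ by
      rw [hxα] at hβ
      rw [Set.mem_singleton_iff.1 hβ, map_neg, hy0, neg_zero]
    rw [map_neg] at this
    linarith
  rcases h.mem_wallCone_or_neg_mem hγ' hx hγ'x with hpos | hneg
  · rw [← key _ hγ' hpos, dact_inv_dact]
    exact hγ.1
  · exfalso
    have e := key _ (R.neg_mem hγ') hneg
    obtain ⟨z, hz⟩ := h.openAlcove_nonempty
    have h1 := hmaps z (openAlcove_subset hz) α hα
    have h2 := hz γ hγ.1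
    have h3 : ∀ u, α (w u) = -γ u := fun u ↦ by
      rw [← e, LinearMap.neg_apply, dact_apply]
    rw [map_add, h3] at h1
    rw [h3, hγ.2] at hαc
    linarith

lemma image_extBase (h : AffineBase R Δ αt n ϖ) {w : V ≃ₗ[ℚ] V} (hw : w ∈ weyl R) {v : V}
    (hv : v ∈ coweightSet R) (hmaps : ∀ c ∈ alcove Δ αt, w c + v ∈ alcove Δ αt)
    (hinv : ∀ c ∈ alcove Δ αt, w⁻¹ (c - v) ∈ alcove Δ αt) :
    dact w '' extBase Δ αt = extBase Δ αt := by
  have hsub : extBase Δ αt ⊆ dact w '' extBase Δ αt := fun α hα ↦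
    ⟨_, h.dact_inv_mem_extBase hw hv hmaps hinv hα, dact_dact_inv w α⟩
  have hfin : (extBase Δ αt).Finite := Δ.finite_toSet.insert _
  exact (Set.eq_of_subset_of_ncard_le hsub
    (Set.ncard_image_of_injective _ (dact_injective w)).le (hfin.image _)).symm

/-- The translation part of an affine transformation preserving the alcove. -/
lemma apply_translation (h : AffineBase R Δ αt n ϖ) {z : V ≃ₗ[ℚ] V} {v : V}
    (himg : (fun x ↦ z x + v) '' alcove Δ αt = alcove Δ αt) {β : Module.Dual ℚ V}
    (hβ : β ∈ extBase Δ αt) (hzβ : dact z β ∈ extBase Δ αt) :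
    dact z β v = mfun αt (dact z β) - mfun αt β := by
  apply le_antisymm
  · obtain ⟨x, hx, hxα⟩ := h.exists_mem_alcove_IOf_eq hzβ
    have hαx : dact z β x = mfun αt (dact z β) := (hxα.symm ▸ rfl : dact z β ∈ IOf Δ αt x).2
    obtain ⟨c, hc, rfl⟩ := himg.symm ▸ hx
    have := hc β hβ
    rw [map_add, dact_apply] at hαx
    linarith
  · obtain ⟨c, hc, hcβ⟩ := h.exists_mem_alcove_IOf_eq hβ
    have hβc : β c = mfun αt β := (hcβ.symm ▸ rfl : β ∈ IOf Δ αt c).2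
    have := (himg ▸ Set.mem_image_of_mem (fun x ↦ z x + v) hc : z c + v ∈ alcove Δ αt) _ hzβ
    rw [map_add, dact_apply] at this
    linarith

lemma simple_apply_lamOf (h : AffineBase R Δ αt n ϖ) {Ω : Set (Module.Dual ℚ V)}
    (hΩ : Ω ⊆ extBase Δ αt) {β : Module.Dual ℚ V} (hβ : β ∈ Δ) :
    β (lamOf n ϖ Ω) = Ω.indicator (fun α ↦ ((n α : ℚ) * Ω.ncard)⁻¹) β := by
  classical
  have hfin : Ω.Finite := (Δ.finite_toSet.insert _).subset hΩ
  rw [lamOf, finsum_mem_eq_finite_toFinset_sum _ hfin, map_sum]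
  have hterm : ∀ α ∈ hfin.toFinset, α ≠ β → β (((n α : ℚ) * Ω.ncard)⁻¹ • ϖ α) = 0 := by
    intro α hα hne
    rcases hΩ (hfin.mem_toFinset.1 hα) with rfl | hα'
    · rw [h.dual_neg_high, smul_zero, map_zero]
    · rw [map_smul, h.dual_ne α hα' β hβ hne.symm, smul_zero]
  by_cases hβΩ : β ∈ Ω
  · rw [Finset.sum_eq_single_of_mem β (hfin.mem_toFinset.2 hβΩ) hterm, map_smul,
      h.dual_self β hβ, Set.indicator_of_mem hβΩ, smul_eq_mul, mul_one]
  · rw [Set.indicator_of_notMem hβΩ]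
    exact Finset.sum_eq_zero fun α hα ↦
      hterm α hα fun e ↦ hβΩ (e ▸ hfin.mem_toFinset.1 hα)

/-- The barycentric coordinates of `λ_Ω`. -/
lemma apply_lamOf (h : AffineBase R Δ αt n ϖ) {Ω : Set (Module.Dual ℚ V)}
    (hΩ : Ω ⊆ extBase Δ αt) (hne : Ω.Nonempty) {β : Module.Dual ℚ V} (hβ : β ∈ extBase Δ αt) :
    β (lamOf n ϖ Ω) =
      mfun αt β + Ω.indicator (fun α ↦ ((n α : ℚ) * Ω.ncard)⁻¹) β := by
  classical
  rcases hβ with rfl | hβ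
  · have hfin : Ω.Finite := (Δ.finite_toSet.insert _).subset hΩ
    have hcard : (Ω.ncard : ℚ) ≠ 0 := by exact_mod_cast (hne.ncard_pos hfin).ne'
    have hn : ∀ β ∈ extBase Δ αt, (n β : ℚ) ≠ 0 := by
      rintro β (rfl | hβ)
      · simp [h.n_neg_high]
      · exact_mod_cast (h.n_pos β hβ).ne'
    have hsum : ∑ β ∈ insert (-αt) Δ,
        (n β : ℚ) * Ω.indicator (fun α ↦ ((n α : ℚ) * Ω.ncard)⁻¹) β = 1 := by
      have hΩ' : hfin.toFinset ⊆ insert (-αt) Δ := fun α hα ↦ by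
        simpa [extBase] using hΩ (hfin.mem_toFinset.1 hα)
      rw [← Finset.sum_subset hΩ' fun β _ hβ ↦ by
        rw [Set.indicator_of_notMem (by simpa using hβ), mul_zero]]
      have : ∀ β ∈ hfin.toFinset,
          (n β : ℚ) * Ω.indicator (fun α ↦ ((n α : ℚ) * Ω.ncard)⁻¹) β = (Ω.ncard : ℚ)⁻¹ := by
        intro β hβ
        have hβ' := hfin.mem_toFinset.1 hβ
        have := hn β (hΩ hβ')
        rw [Set.indicator_of_mem hβ']
        field_simp
      rw [Finset.sum_congr rfl this, Finset.sum_const, ← Set.ncard_eq_toFinset_card Ω hfin,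
        nsmul_eq_mul, mul_inv_cancel₀ hcard]
    rw [Finset.sum_insert h.neg_high_notMem, h.n_neg_high, Nat.cast_one, one_mul] at hsum
    rw [mfun_neg_high, LinearMap.neg_apply, h.high_apply,
      Finset.sum_congr rfl fun β hβ ↦ by rw [h.simple_apply_lamOf hΩ hβ]]
    linarith
  · rw [h.simple_apply_lamOf hΩ hβ, h.mfun_simple hβ, zero_add]

lemma lamOf_coordinate_pos (h : AffineBase R Δ αt n ϖ) {Ω : Set (Module.Dual ℚ V)}
    (hΩ : Ω ⊆ extBase Δ αt) {β : Module.Dual ℚ V} (hβ : β ∈ Ω) :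
    0 < ((n β : ℚ) * Ω.ncard)⁻¹ := by
  have hfin : Ω.Finite := (Δ.finite_toSet.insert _).subset hΩ
  have hne : Ω.Nonempty := ⟨β, hβ⟩
  have hcard : 0 < Ω.ncard := hne.ncard_pos hfin
  have hn : 0 < n β := by
    rcases hΩ hβ with rfl | hβ
    · simp [h.n_neg_high]
    · exact h.n_pos β hβ
  positivity

lemma lamOf_mem_alcove (h : AffineBase R Δ αt n ϖ) {Ω : Set (Module.Dual ℚ V)}
    (hΩ : Ω ⊆ extBase Δ αt) (hne : Ω.Nonempty) : lamOf n ϖ Ω ∈ alcove Δ αt := by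
  intro β hβ
  rw [h.apply_lamOf hΩ hne hβ]
  exact le_add_of_nonneg_right
    (Set.indicator_nonneg (fun β hβ ↦ (h.lamOf_coordinate_pos hΩ hβ).le) β)

lemma IOf_lamOf (h : AffineBase R Δ αt n ϖ) {Ω : Set (Module.Dual ℚ V)}
    (hΩ : Ω ⊆ extBase Δ αt) (hne : Ω.Nonempty) :
    IOf Δ αt (lamOf n ϖ Ω) = extBase Δ αt \ Ω := by
  ext β
  refine and_congr_right fun hβ ↦ ?_
  rw [h.apply_lamOf hΩ hne hβ, add_eq_left]
  refine ⟨fun e hβΩ ↦ ?_, fun hβΩ ↦ Set.indicator_of_notMem hβΩ _⟩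
  rw [Set.indicator_of_mem hβΩ] at e
  exact (h.lamOf_coordinate_pos hΩ hβΩ).ne' e

/-- An affine transformation preserving the alcove whose linear part stabilizes `Ω` fixes
`λ_Ω`. -/
lemma map_lamOf (h : AffineBase R Δ αt n ϖ) {Ω : Set (Module.Dual ℚ V)}
    (hΩ : Ω ⊆ extBase Δ αt) (hne : Ω.Nonempty) (hconst : ∀ α ∈ Ω, ∀ β ∈ Ω, n α = n β)
    {z : V ≃ₗ[ℚ] V} (hz : dact z '' extBase Δ αt = extBase Δ αt) {v : V}
    (himg : (fun x ↦ z x + v) '' alcove Δ αt = alcove Δ αt) (hzΩ : dact z '' Ω = Ω) :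
    z (lamOf n ϖ Ω) + v = lamOf n ϖ Ω := by
  refine h.eq_of_forall_simple fun α hα ↦ ?_
  have hα' : α ∈ extBase Δ αt := Or.inr hα
  obtain ⟨β, hβ, rfl⟩ := hz.symm ▸ hα'
  have hiff : dact z β ∈ Ω ↔ β ∈ Ω := by
    conv_lhs => rw [← hzΩ]
    exact (dact_injective z).mem_set_image
  rw [map_add, dact_apply, h.apply_translation himg hβ hα', h.apply_lamOf hΩ hne hβ,
    h.apply_lamOf hΩ hne hα']
  by_cases hβΩ : β ∈ Ω
  · rw [Set.indicator_of_mem hβΩ, Set.indicator_of_mem (hiff.2 hβΩ),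
      hconst β hβΩ _ (hiff.2 hβΩ)]
    ring
  · rw [Set.indicator_of_notMem hβΩ, Set.indicator_of_notMem (mt hiff.1 hβΩ)]
    ring

lemma image_diff_iff {z : V ≃ₗ[ℚ] V} {Ω : Set (Module.Dual ℚ V)}
    (hΩ : Ω ⊆ extBase Δ αt) (hz : dact z '' extBase Δ αt = extBase Δ αt) :
    dact z '' (extBase Δ αt \ Ω) = extBase Δ αt \ Ω ↔ dact z '' Ω = Ω := by
  rw [Set.image_sdiff (dact_injective z), hz]
  refine ⟨fun e ↦ ?_, fun e ↦ by rw [e]⟩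
  have hsub : dact z '' Ω ⊆ extBase Δ αt := hz ▸ Set.image_mono hΩ
  rw [← Set.sdiff_sdiff_cancel_left hsub, e, Set.sdiff_sdiff_cancel_left hΩ]

/-- If `w` stabilizes the walls through a point `x` of the alcove, then `w` permutes the extended
base, and the affine transformation with linear part `w` that fixes `x` stabilizes the alcove. -/
lemma image_alcove_of_image_IOf (h : AffineBase R Δ αt n ϖ) {w : V ≃ₗ[ℚ] V} (hw : w ∈ weyl R)
    {x : V} (hx : x ∈ alcove Δ αt) (hI : dact w '' IOf Δ αt x = IOf Δ αt x)
    (hv : x - w x ∈ coweightSet R) :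
    dact w '' extBase Δ αt = extBase Δ αt ∧
      (fun c ↦ w c + (x - w x)) '' alcove Δ αt = alcove Δ αt := by
  have hmaps : ∀ c ∈ alcove Δ αt, w c + (x - w x) ∈ alcove Δ αt := fun c hc ↦
    h.mapsTo_alcove_of_image_IOf hw hx hI hv hc
  have hI' : dact w⁻¹ '' IOf Δ αt x = IOf Δ αt x := by
    conv_lhs => rw [← hI]
    rw [Set.image_image]
    simp only [dact_inv_dact, Set.image_id']
  have hww : ∀ u, w⁻¹ (w u) = u := fun u ↦ by
    rw [← LinearEquiv.mul_apply, inv_mul_cancel, LinearEquiv.coe_one, id_eq]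
  have hww' : ∀ u, w (w⁻¹ u) = u := fun u ↦ by
    rw [← LinearEquiv.mul_apply, mul_inv_cancel, LinearEquiv.coe_one, id_eq]
  have hv' : x - w⁻¹ x ∈ coweightSet R := fun α hα ↦ by
    obtain ⟨k, hk⟩ := hv _ (dact_mem R hw hα)
    refine ⟨-k, ?_⟩
    have e : x - w x = w (w⁻¹ x - x) := by rw [map_sub, hww']
    rw [e, dact_apply, map_sub] at hk
    push_cast
    rw [hk, map_sub]
    ring
  have hinv : ∀ c ∈ alcove Δ αt, w⁻¹ (c - (x - w x)) ∈ alcove Δ αt := fun c hc ↦ by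
    convert h.mapsTo_alcove_of_image_IOf (inv_mem hw) hx hI' hv' hc using 1
    rw [map_sub, map_sub, hww]
    abel
  refine ⟨h.image_extBase hw hv hmaps hinv, Set.Subset.antisymm ?_ fun c hc ↦
    ⟨_, hinv c hc, ?_⟩⟩
  · rintro _ ⟨c, hc, rfl⟩
    exact hmaps c hc
  · simp only [hww', sub_add_cancel]

lemma eq_zero_of_forall_ne (h : AffineBase R Δ αt n ϖ) {a : Module.Dual ℚ V}
    (ha : a ∈ extBase Δ αt) {v : V} (hv : ∀ β ∈ extBase Δ αt, β ≠ a → β v = 0) : v = 0 := by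
  refine h.eq_of_forall_simple fun β hβ ↦ ?_
  rw [map_zero]
  by_cases hβa : β = a
  · subst hβa
    have hne : ∀ γ ∈ Δ, γ ≠ β → (n γ : ℚ) * γ v = 0 := fun γ hγ hγβ ↦ by
      rw [hv γ (Or.inr hγ) hγβ, mul_zero]
    have h1 := hv (-αt) (Or.inl rfl) fun e ↦ h.neg_high_notMem (e ▸ hβ)
    rw [LinearMap.neg_apply, neg_eq_zero, h.high_apply, Finset.sum_eq_single_of_mem β hβ hne] at h1
    exact (mul_eq_zero.1 h1).resolve_left (by exact_mod_cast (h.n_pos β hβ).ne')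
  · exact hv β (Or.inr hβ) hβa

/-- The extended base outside `Ω` kills no nonzero vector if and only if `Ω` is
a singleton. -/
lemma forall_eq_zero_iff (h : AffineBase R Δ αt n ϖ) {Ω : Set (Module.Dual ℚ V)}
    (hΩ : Ω ⊆ extBase Δ αt) (hne : Ω.Nonempty) :
    (∀ v, (∀ β ∈ extBase Δ αt \ Ω, β v = 0) → v = 0) ↔ ∃ a, Ω = {a} := by
  classical
  constructor
  · intro hall
    obtain ⟨b, hb⟩ := hne
    refine ⟨b, Set.eq_singleton_iff_unique_mem.2 ⟨hb, fun a ha ↦ ?_⟩⟩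
    by_contra hab
    obtain ⟨v, hv⟩ := h.exists_interpolation (hΩ hb) (fun β ↦ if β = a then 1 else 0)
    have hv0 := hall v fun β hβ ↦ by
      rw [hv β hβ.1 (ne_of_mem_of_not_mem hb hβ.2).symm,
        if_neg (ne_of_mem_of_not_mem ha hβ.2).symm]
    have := hv a (hΩ ha) hab
    rw [hv0, map_zero, if_pos rfl] at this
    exact zero_ne_one this
  · rintro ⟨a, rfl⟩ v hv
    exact h.eq_zero_of_forall_ne (hΩ rfl) fun β hβ hne ↦ hv β ⟨hβ, hne⟩

end AffineBase

/-- A base of a root system expanding the highest root gives an `AffineBase`. -/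
lemma AffineBase.of_base (R : RootSystemData V) (Δ : Finset (Module.Dual ℚ V))
    (hΔΦ : (Δ : Set (Module.Dual ℚ V)) ⊆ R.Φ)
    (hΔbase : ∀ α ∈ R.Φ, ∃ c : Module.Dual ℚ V →₀ ℤ,
        (c.support : Set (Module.Dual ℚ V)) ⊆ (Δ : Set (Module.Dual ℚ V)) ∧
        α = c.sum (fun β k => (k : ℚ) • β) ∧
        ((∀ β, 0 ≤ c β) ∨ (∀ β, c β ≤ 0)))
    (αt : Module.Dual ℚ V) (hαtΦ : αt ∈ R.Φ)
    (hhigh : ∀ γ ∈ R.Φ, ∃ c : Module.Dual ℚ V →₀ ℚ,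
        (c.support : Set (Module.Dual ℚ V)) ⊆ (Δ : Set (Module.Dual ℚ V)) ∧
        αt - γ = c.sum (fun β k => k • β) ∧ (∀ β, 0 ≤ c β))
    (hα₀ : -αt ∉ (Δ : Set (Module.Dual ℚ V)))
    (n : Module.Dual ℚ V → ℕ)
    (hnsum : αt = ∑ β ∈ Δ, (n β : ℚ) • β)
    (hnpos : ∀ β ∈ Δ, 0 < n β)
    (hn0 : n (-αt) = 1)
    (ϖ : Module.Dual ℚ V → V)
    (hϖ : ∀ β ∈ Δ, β (ϖ β) = 1 ∧ ∀ γ ∈ Δ, γ ≠ β → γ (ϖ β) = 0)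
    (hϖ0 : ϖ (-αt) = 0) : AffineBase R Δ αt n ϖ := by
  have heval : ∀ (d : Module.Dual ℚ V → ℚ) (β) (_ : β ∈ Δ), (∑ γ ∈ Δ, d γ • γ) (ϖ β) = d β := by
    intro d β hβ
    rw [LinearMap.sum_apply, Finset.sum_eq_single_of_mem β hβ]
    · simp [(hϖ β hβ).1]
    · intro γ hγ hne
      simp [(hϖ β hβ).2 γ hγ hne]
  have hroot : ∀ α ∈ R.Φ, ∃ c : Module.Dual ℚ V →₀ ℤ, α = ∑ β ∈ Δ, (c β : ℚ) • β ∧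
      ((∀ β, 0 ≤ c β) ∨ (∀ β, c β ≤ 0)) := by
    intro α hα
    obtain ⟨c, hsupp, hc, hsign⟩ := hΔbase α hα
    refine ⟨c, ?_, hsign⟩
    rw [Finsupp.sum_of_support_subset c (by exact_mod_cast hsupp) _ (by simp)] at hc
    exact hc
  refine ⟨fun β hβ ↦ hΔΦ hβ, hαtΦ, hα₀, hnsum, hnpos, hn0, fun β hβ ↦ (hϖ β hβ).1,
    fun β hβ ↦ (hϖ β hβ).2, hϖ0, fun f ↦ ?_, fun α hα ↦ ?_, fun α hα β hβ ↦ ?_⟩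
  · have hf : f ∈ Submodule.span ℚ R.Φ := R.span_eq_top ▸ Submodule.mem_top
    induction hf using Submodule.span_induction with
    | mem α hα =>
      obtain ⟨c, hc, -⟩ := hroot α hα
      conv_lhs => rw [hc]
      refine Finset.sum_congr rfl fun β hβ ↦ ?_
      rw [hc, heval (fun γ ↦ (c γ : ℚ)) β hβ]
    | zero => simp
    | add f g _ _ hf hg =>
      conv_lhs => rw [hf, hg]
      simp [add_smul, Finset.sum_add_distrib]
    | smul a f _ hf =>
      conv_lhs => rw [hf]
      simp [Finset.smul_sum, mul_smul]
  · obtain ⟨c, hc, hsign⟩ := hroot α hα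
    have hcoord : ∀ β ∈ Δ, α (ϖ β) = c β := fun β hβ ↦ by
      rw [hc, heval (fun γ ↦ (c γ : ℚ)) β hβ]
    refine hsign.imp (fun hs β hβ ↦ ?_) fun hs β hβ ↦ ?_
    · rw [hcoord β hβ]
      exact_mod_cast hs β
    · rw [hcoord β hβ]
      exact_mod_cast hs β
  · obtain ⟨c, hsupp, hc, hpos⟩ := hhigh α hα
    rw [Finsupp.sum_of_support_subset c (by exact_mod_cast hsupp) _ (by simp)] at hc
    have h1 := LinearMap.congr_fun hc (ϖ β)
    have h2 : αt (ϖ β) = n β := by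
      conv_lhs => rw [hnsum]
      exact heval (fun γ ↦ (n γ : ℚ)) β hβ
    rw [heval c β hβ, LinearMap.sub_apply, h2] at h1
    linarith [hpos β]

/-- Let Ω ⊆ Δ̃ be nonempty with n constant on Ω, and λ_Ω as above.
Then (α) λ_Ω ∈ C, I_{λ_Ω} = Δ̃ ∖ Ω and W°(λ_Ω) is generated by the reflections s_α,
α ∈ Δ̃ ∖ Ω; (β) {w ∈ W | w(λ_Ω)−λ_Ω ∈ L, w(Δ̃∖Ω) = Δ̃∖Ω} = {z ∈ 𝒜_L | z(Ω) = Ω};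
(δ) λ_Ω is isolated iff |Ω| = 1. -/
theorem lamOf_properties
    {V : Type*} [AddCommGroup V] [Module ℚ V] [FiniteDimensional ℚ V]
    (R : RootSystemData V)
    (Δ : Finset (Module.Dual ℚ V))
    (hΔΦ : (Δ : Set (Module.Dual ℚ V)) ⊆ R.Φ)
    (hΔind : LinearIndependent ℚ
      (fun x : (Δ : Set (Module.Dual ℚ V)) => (x : Module.Dual ℚ V)))
    (hΔbase : ∀ α ∈ R.Φ, ∃ c : Module.Dual ℚ V →₀ ℤ,
        (c.support : Set (Module.Dual ℚ V)) ⊆ (Δ : Set (Module.Dual ℚ V)) ∧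
        α = c.sum (fun β k => (k : ℚ) • β) ∧
        ((∀ β, 0 ≤ c β) ∨ (∀ β, c β ≤ 0)))
    (αt : Module.Dual ℚ V) (hαtΦ : αt ∈ R.Φ)
    (hhigh : ∀ γ ∈ R.Φ, ∃ c : Module.Dual ℚ V →₀ ℚ,
        (c.support : Set (Module.Dual ℚ V)) ⊆ (Δ : Set (Module.Dual ℚ V)) ∧
        αt - γ = c.sum (fun β k => k • β) ∧ (∀ β, 0 ≤ c β))
    (hα₀ : -αt ∉ (Δ : Set (Module.Dual ℚ V)))
    (L : AddSubgroup V)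
    (hQL : (corootLattice R : Set V) ⊆ (L : Set V))
    (hLP : (L : Set V) ⊆ coweightSet R)
    (n : Module.Dual ℚ V → ℕ)
    (hnsum : αt = ∑ β ∈ Δ, (n β : ℚ) • β)
    (hnpos : ∀ β ∈ Δ, 0 < n β)
    (hn0 : n (-αt) = 1)
    (ϖ : Module.Dual ℚ V → V)
    (hϖ : ∀ β ∈ Δ, β (ϖ β) = 1 ∧ ∀ γ ∈ Δ, γ ≠ β → γ (ϖ β) = 0)
    (hϖ0 : ϖ (-αt) = 0)
    (Ω : Set (Module.Dual ℚ V)) (hΩ : Ω ⊆ extBase Δ αt) (hΩne : Ω.Nonempty)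
    (hconst : ∀ α ∈ Ω, ∀ β ∈ Ω, n α = n β) :
    (lamOf n ϖ Ω ∈ alcove Δ αt ∧
      IOf Δ αt (lamOf n ϖ Ω) = extBase Δ αt \ Ω ∧
      Wcirc R (lamOf n ϖ Ω) = weylOf R (extBase Δ αt \ Ω)) ∧
    ({w : V ≃ₗ[ℚ] V | w ∈ weyl R ∧ w (lamOf n ϖ Ω) - lamOf n ϖ Ω ∈ L ∧
        dact w '' (extBase Δ αt \ Ω) = extBase Δ αt \ Ω}
      = {z : V ≃ₗ[ℚ] V | z ∈ AutTildeL R Δ αt L ∧ dact z '' Ω = Ω}) ∧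
    ((fixedSub (Wcirc R (lamOf n ϖ Ω) : Set (V ≃ₗ[ℚ] V)) = ⊥) ↔ ∃ a, Ω = {a}) := by
  have h := AffineBase.of_base R Δ hΔΦ hΔbase αt hαtΦ hhigh hα₀ n hnsum hnpos hn0 ϖ hϖ hϖ0
  have hmem := h.lamOf_mem_alcove hΩ hΩne
  have hI := h.IOf_lamOf hΩ hΩne
  have hW : Wcirc R (lamOf n ϖ Ω) = weylOf R (extBase Δ αt \ Ω) := by rw [h.Wcirc_eq hmem, hI]
  refine ⟨⟨hmem, hI, hW⟩, Set.ext fun w ↦ ⟨?_, ?_⟩, ?_⟩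
  · rintro ⟨hw, hwL, hwI⟩
    have hv : lamOf n ϖ Ω - w (lamOf n ϖ Ω) ∈ L := by
      rw [← neg_sub]
      exact neg_mem hwL
    obtain ⟨hext, himg⟩ :=
      h.image_alcove_of_image_IOf hw hmem (by rw [hI, hwI]) (hLP hv)
    exact ⟨⟨⟨hw, hext⟩, _, hv, himg⟩, (AffineBase.image_diff_iff hΩ hext).1 hwI⟩
  · rintro ⟨⟨⟨hw, hext⟩, v, hv, himg⟩, hwΩ⟩
    refine ⟨hw, ?_, (AffineBase.image_diff_iff hΩ hext).2 hwΩ⟩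
    have e := h.map_lamOf hΩ hΩne hconst hext himg hwΩ
    rw [eq_sub_of_add_eq e, sub_sub_cancel_left]
    exact neg_mem hv
  · rw [hW, ← h.forall_eq_zero_iff hΩ hΩne, Submodule.eq_bot_iff]
    have hsub : extBase Δ αt \ Ω ⊆ R.Φ := fun β hβ ↦ h.ext_mem hβ.1
    simp only [mem_fixedSub_weylOf_iff R hsub]
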